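/- arXiv:2102.02172 — 2 statements merged into one kernel-verified Lean document; each statement's English description precedes it below -/
import Mathlib

section
/- Let s ∈ ℝ⁴ be a point of the frontier (topological boundary) of A such that for every w ∈ W*, the vector w·s has at most one zero coordinate (i.e. s does not lie in the 2-skeleton of A). Then for every w ∈ W*, the vector w·s has exactly three positive coordinates and one negative coordinate. -/
open Finset Complex

noncomputable section

/-- The Descartes quadratic form `F(x) = 2(x₁²+x₂²+x₃²+x₄²) − (x₁+x₂+x₃+x₄)²`. -/
def DescartesF (x : Fin 4 → ℝ) : ℝ := 2 * (∑ i, (x i)^2) - (∑ i, x i)^2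

/-- Height of a vector: the sum of its coordinates. -/
def ht (x : Fin 4 → ℝ) : ℝ := ∑ i, x i

/-- The dual Apollonian reflection as a linear map: it sends `s` to the vector with `i`-th
coordinate `−sᵢ` and `j`-th coordinate `sⱼ + 2sᵢ` for `j ≠ i`. -/
def tauL (i : Fin 4) : (Fin 4 → ℝ) →ₗ[ℝ] (Fin 4 → ℝ) where
  toFun s := fun j => if j = i then -s i else s j + 2 * s i
  map_add' x y := by
    funext j
    rcases eq_or_ne j i with h | h <;> simp [h] <;> ring
  map_smul' r x := by
    funext j
    rcases eq_or_ne j i with h | h <;> simp [h] <;> ring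

lemma tauL_invol (i : Fin 4) : Function.Involutive (tauL i) := by
  intro x
  funext j
  rcases eq_or_ne j i with h | h <;> simp [tauL, h] <;> ring

/-- The dual Apollonian reflection `τᵢ` (the transpose of `σᵢ`) as a linear automorphism. -/
def apTau (i : Fin 4) : (Fin 4 → ℝ) ≃ₗ[ℝ] (Fin 4 → ℝ) :=
  LinearEquiv.ofInvolutive (tauL i) (tauL_invol i)

/-- The dual Apollonian group `W* = ⟨τ₁, τ₂, τ₃, τ₄⟩`. -/
def apWstar : Subgroup ((Fin 4 → ℝ) ≃ₗ[ℝ] (Fin 4 → ℝ)) :=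
  Subgroup.closure {apTau 0, apTau 1, apTau 2, apTau 3}

/-- The set `C = {s ∈ ℝ⁴ : sᵢ ≥ 0 for all i, and at most one sᵢ = 0}`. -/
def setC : Set (Fin 4 → ℝ) :=
  {s | (∀ i, 0 ≤ s i) ∧ ∀ i j, s i = 0 → s j = 0 → i = j}

/-- The Apollonian cone `A = ⋃_{w ∈ W*} w(C)`. -/
def setA : Set (Fin 4 → ℝ) :=
  ⋃ w ∈ apWstar, (w : (Fin 4 → ℝ) ≃ₗ[ℝ] (Fin 4 → ℝ)) '' setC


abbrev V4 := Fin 4 → ℝ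

lemma apTau_apply (i j : Fin 4) (x : V4) :
    apTau i x j = if j = i then -x i else x j + 2 * x i := rfl

lemma apTau_same (i : Fin 4) (x : V4) : apTau i x i = -x i := by simp [apTau_apply]

lemma apTau_ne (i j : Fin 4) (h : j ≠ i) (x : V4) : apTau i x j = x j + 2 * x i := by
  simp [apTau_apply, h]

lemma apTau_apTau (i : Fin 4) (x : V4) : apTau i (apTau i x) = x := tauL_invol i x

lemma apTau_mem (i : Fin 4) : apTau i ∈ apWstar := by
  apply Subgroup.subset_closure
  fin_cases i <;> simp

lemma apTau_inv (i : Fin 4) : (apTau i)⁻¹ = apTau i := by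
  rw [inv_eq_iff_mul_eq_one]
  ext1 x
  exact apTau_apTau i x

/-- Points reached from `C` by reduced words, recording the last letter. -/
inductive Red : Option (Fin 4) → V4 → Prop
  | base (c : V4) (hc : c ∈ setC) : Red none c
  | step (o : Option (Fin 4)) (x : V4) (k : Fin 4) (hk : o ≠ some k) (h : Red o x) :
      Red (some k) (apTau k x)

lemma Red.inv {o : Option (Fin 4)} {x : V4} (h : Red o x) :
    (∀ i j, i ≠ j → 0 < x i + x j) ∧ (∀ k, o = some k → x k ≤ 0) ∧
      (∀ k, o ≠ some k → 0 ≤ x k) := by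
  induction h with
  | base c hc =>
    refine ⟨fun i j hij => ?_, by simp, fun k _ => hc.1 k⟩
    have h1 := hc.1 i
    have h2 := hc.1 j
    by_contra hcon
    exact hij (hc.2 i j (by linarith) (by linarith))
  | step o x k hk h ih =>
    obtain ⟨h1, h2, h3⟩ := ih
    have hxk := h3 k hk
    have key : ∀ j, j ≠ k → 0 < apTau k x k + apTau k x j := by
      intro j hj
      rw [apTau_same, apTau_ne k j hj]
      have := h1 j k hj
      linarith
    refine ⟨fun i j hij => ?_, ?_, ?_⟩
    · by_cases hi : i = k
      · subst hi; exact key j hij.symm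
      · by_cases hj : j = k
        · subst hj; have := key i hi; linarith
        · rw [apTau_ne k i hi, apTau_ne k j hj]
          have := h1 i j hij
          linarith
    · intro l hl
      obtain rfl : k = l := by simpa using hl
      rw [apTau_same]; linarith
    · intro l hl
      have hl' : l ≠ k := fun e => hl (by rw [e])
      have := key l hl'
      rw [apTau_same] at this
      linarith

lemma Red.tau {o : Option (Fin 4)} {x : V4} (h : Red o x) (k : Fin 4) :
    ∃ o', Red o' (apTau k x) := by
  by_cases hk : o = some k
  · cases h with
    | base c hc => simp at hk
    | step o' y l hl hy =>
      obtain rfl : l = k := by simpa using hk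
      exact ⟨o', by rw [apTau_apTau]; exact hy⟩
  · exact ⟨_, Red.step o x k hk h⟩

lemma red_w (w : V4 ≃ₗ[ℝ] V4) (hw : w ∈ apWstar) :
    ∀ x, (∃ o, Red o x) → ∃ o, Red o (w x) := by
  have gen : ∀ g ∈ ({apTau 0, apTau 1, apTau 2, apTau 3} : Set (V4 ≃ₗ[ℝ] V4)),
      ∃ k, g = apTau k := by
    rintro g (rfl | rfl | rfl | rfl) <;> exact ⟨_, rfl⟩
  unfold apWstar at hw
  induction hw using Subgroup.closure_induction'' with
  | mem g hg =>
    obtain ⟨k, rfl⟩ := gen g hg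
    rintro x ⟨o, h⟩
    exact h.tau k
  | inv_mem g hg =>
    obtain ⟨k, rfl⟩ := gen g hg
    rintro x ⟨o, h⟩
    rw [apTau_inv]
    exact h.tau k
  | one => intro x h; exact h
  | mul a b _ _ ha hb => intro x h; exact ha _ (hb _ h)

lemma mem_setA {x : V4} : x ∈ setA ↔ ∃ w ∈ apWstar, ∃ c ∈ setC, w c = x := by
  simp [setA]

lemma setA_sum {x : V4} (hx : x ∈ setA) (i j : Fin 4) (hij : i ≠ j) : 0 < x i + x j := by
  obtain ⟨w, hw, c, hc, rfl⟩ := mem_setA.1 hx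
  obtain ⟨o, ho⟩ := red_w w hw c ⟨_, Red.base c hc⟩
  exact ho.inv.1 i j hij

lemma closure_sum {x : V4} (hx : x ∈ closure setA) (i j : Fin 4) (hij : i ≠ j) :
    0 ≤ x i + x j := by
  have hcl : IsClosed {y : V4 | 0 ≤ y i + y j} :=
    isClosed_le continuous_const (by fun_prop)
  exact closure_minimal (fun y hy => (setA_sum hy i j hij).le) hcl hx

lemma image_setA (w : V4 ≃ₗ[ℝ] V4) (hw : w ∈ apWstar) : w '' setA = setA := by
  have sub : ∀ v ∈ apWstar, ∀ x ∈ setA, (v : V4 ≃ₗ[ℝ] V4) x ∈ setA := by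
    intro v hv x hx
    obtain ⟨u, hu, c, hc, rfl⟩ := mem_setA.1 hx
    exact mem_setA.2 ⟨v * u, mul_mem hv hu, c, hc, rfl⟩
  ext x
  constructor
  · rintro ⟨y, hy, rfl⟩; exact sub w hw y hy
  · intro hx
    exact ⟨w⁻¹ x, sub _ (inv_mem hw) x hx, w.apply_symm_apply x⟩

lemma setC_subset_interior : setC ⊆ interior setA := by
  intro x hx
  have hpos : ∃ i, ∀ j, j ≠ i → 0 < x j ∧ 0 < x j + 2 * x i := by
    have aux : ∀ i, (∀ j, j ≠ i → x j ≠ 0) → ∀ j, j ≠ i → 0 < x j ∧ 0 < x j + 2 * x i := by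
      intro i h j hj
      have := lt_of_le_of_ne (hx.1 j) (h j hj).symm
      have h2 := hx.1 i
      exact ⟨this, by linarith⟩
    by_cases hz : ∃ i, x i = 0
    · obtain ⟨i, hi⟩ := hz
      exact ⟨i, aux i fun j hj h0 => hj (hx.2 j i h0 hi)⟩
    · push Not at hz
      exact ⟨0, aux 0 fun j _ => hz j⟩
  obtain ⟨i, hi⟩ := hpos
  refine mem_interior.2 ⟨{y : V4 | ∀ j, j ≠ i → 0 < y j ∧ 0 < y j + 2 * y i}, ?_, ?_, hi⟩
  · intro y hy
    have mk : ∀ z : V4, 0 ≤ z i → (∀ j, j ≠ i → 0 < z j) → z ∈ setC := by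
      intro z hzi hz
      have hne : ∀ a, z a = 0 → a = i := fun a ha => by
        by_contra hai
        exact (hz a hai).ne' ha
      refine ⟨fun j => ?_, fun a b ha hb => (hne a ha).trans (hne b hb).symm⟩
      by_cases hj : j = i
      · rw [hj]; exact hzi
      · exact (hz j hj).le
    rcases le_total 0 (y i) with h | h
    · exact mem_setA.2 ⟨1, one_mem _, y, mk y h fun j hj => (hy j hj).1, rfl⟩
    · refine mem_setA.2 ⟨apTau i, apTau_mem i, apTau i y, mk _ ?_ ?_, apTau_apTau i y⟩
      · rw [apTau_same]; linarith
      · intro j hj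
        rw [apTau_ne i j hj]
        exact (hy j hj).2
  · simp only [Set.ofPred_forall]
    refine isOpen_iInter_of_finite fun j => isOpen_iInter_of_finite fun _ => ?_
    have o1 : IsOpen {y : V4 | 0 < y j} := isOpen_lt continuous_const (by fun_prop)
    have o2 : IsOpen {y : V4 | 0 < y j + 2 * y i} := isOpen_lt continuous_const (by fun_prop)
    exact o1.inter o2

/-- A boundary point of the Apollonian cone `A` not on the 2-skeleton (i.e. all of whose
`W*`-translates have at most one zero coordinate) has, for every `w ∈ W*`, exactly three
positive coordinates and one negative coordinate. -/
theorem frontier_three_pos_one_neg (s : Fin 4 → ℝ) (hs : s ∈ frontier setA)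
    (hzero : ∀ w ∈ apWstar, ∀ i j : Fin 4,
      (w : (Fin 4 → ℝ) ≃ₗ[ℝ] (Fin 4 → ℝ)) s i = 0 → (w : (Fin 4 → ℝ) ≃ₗ[ℝ] (Fin 4 → ℝ)) s j = 0 → i = j) :
    ∀ w ∈ apWstar, ∃ i : Fin 4, (w : (Fin 4 → ℝ) ≃ₗ[ℝ] (Fin 4 → ℝ)) s i < 0 ∧
      ∀ j : Fin 4, j ≠ i → 0 < (w : (Fin 4 → ℝ) ≃ₗ[ℝ] (Fin 4 → ℝ)) s j := by
  intro w hw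
  have hf : w s ∈ frontier setA := by
    have h1 : w.toContinuousLinearEquiv.toHomeomorph '' frontier setA =
        frontier (w.toContinuousLinearEquiv.toHomeomorph '' setA) :=
      Homeomorph.image_frontier _ _
    have h2 : w.toContinuousLinearEquiv.toHomeomorph '' setA = setA := image_setA w hw
    rw [h2] at h1
    rw [← h1]
    exact ⟨s, hs, rfl⟩
  have hneg : ∃ i, w s i < 0 := by
    by_contra hcon
    push Not at hcon
    exact hf.2 (setC_subset_interior ⟨hcon, hzero w hw⟩)
  obtain ⟨i, hi⟩ := hneg
  refine ⟨i, hi, fun j hj => ?_⟩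
  have := closure_sum hf.1 j i hj
  linarith
end
end

section
/- Let c ∈ ℝ⁴ be a base quadruple of a bounded Apollonian packing, and let x = w·c for some w ∈ W with x ≠ c. Then there exists a unique i ∈ {1,2,3,4} with xᵢ > Σ_{j≠i} xⱼ (equivalently, a unique i such that ht(σᵢ·x) < ht(x)), and for this i, xᵢ ≥ xⱼ for all j. (Every Descartes quadruple in the packing other than the base quadruple admits a unique Apollonian reflection decreasing its height, which replaces its largest curvature.) -/
open Finset Complex

noncomputable section

/-- The Apollonian reflection as a linear map: it replaces the `i`-th coordinate `xᵢ`
by `2(Σ_{j≠i} xⱼ) − xᵢ = 2(Σ_j xⱼ) − 3xᵢ` and fixes the other coordinates. -/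
def sigmaL (i : Fin 4) : (Fin 4 → ℝ) →ₗ[ℝ] (Fin 4 → ℝ) where
  toFun x := Function.update x i (2 * (∑ j, x j) - 3 * x i)
  map_add' x y := by
    funext j
    rcases eq_or_ne j i with h | h
    · subst h; simp [Function.update_self, Finset.sum_add_distrib]; ring
    · simp [Function.update_of_ne h]
  map_smul' r x := by
    funext j
    rcases eq_or_ne j i with h | h
    · subst h
      simp only [Pi.smul_apply, smul_eq_mul, Function.update_self, RingHom.id_apply]
      rw [← Finset.mul_sum]
      ring
    · simp [Function.update_of_ne h]

lemma sigmaL_invol (i : Fin 4) : Function.Involutive (sigmaL i) := by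
  intro x
  funext j
  have hsum : ∑ k, Function.update x i (2 * (∑ j, x j) - 3 * x i) k
      = 3 * (∑ k, x k) - 4 * x i := by
    rw [Finset.sum_update_of_mem (Finset.mem_univ i)]
    have : ∑ k ∈ Finset.univ \ {i}, x k = (∑ k, x k) - x i := by
      rw [Finset.sum_sdiff_eq_sub (Finset.subset_univ _), Finset.sum_singleton]
    rw [this]; ring
  rcases eq_or_ne j i with h | h
  · subst h
    simp only [sigmaL, LinearMap.coe_mk, AddHom.coe_mk, Function.update_self, hsum]
    ring
  · simp [sigmaL, Function.update_of_ne h]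

/-- The Apollonian reflection `σᵢ` as a linear automorphism of `ℝ⁴`. -/
def apSigma (i : Fin 4) : (Fin 4 → ℝ) ≃ₗ[ℝ] (Fin 4 → ℝ) :=
  LinearEquiv.ofInvolutive (sigmaL i) (sigmaL_invol i)

/-- The Apollonian group `W`, generated by the four reflections `σ₁, σ₂, σ₃, σ₄`. -/
def apW : Subgroup ((Fin 4 → ℝ) ≃ₗ[ℝ] (Fin 4 → ℝ)) :=
  Subgroup.closure {apSigma 0, apSigma 1, apSigma 2, apSigma 3}

/-- `c` is a base quadruple of a bounded Apollonian packing: `F(c) = 0`, exactly one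
coordinate of `c` is negative, and `2cᵢ ≤ ht(c)` for every `i`. -/
def IsBaseQuadruple (c : Fin 4 → ℝ) : Prop :=
  DescartesF c = 0 ∧ (∃! i, c i < 0) ∧ ∀ i, 2 * c i ≤ ht c


inductive ApReach (c : Fin 4 → ℝ) : (Fin 4 → ℝ) → Prop
  | base : ApReach c c
  | step (y : Fin 4 → ℝ) (k : Fin 4) : ApReach c y → 2 * y k < ht y → ApReach c (apSigma k y)

lemma apSigma_self (k : Fin 4) (y : Fin 4 → ℝ) : apSigma k y k = 2 * ht y - 3 * y k := by
  simp [apSigma, sigmaL, ht]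

lemma apSigma_ne (k j : Fin 4) (y : Fin 4 → ℝ) (h : j ≠ k) : apSigma k y j = y j := by
  simp [apSigma, sigmaL, h]

lemma apSigma_apSigma (k : Fin 4) (y : Fin 4 → ℝ) : apSigma k (apSigma k y) = y :=
  sigmaL_invol k y

lemma ht_apSigma (k : Fin 4) (y : Fin 4 → ℝ) : ht (apSigma k y) = 3 * ht y - 4 * y k := by
  have h1 : ht (apSigma k y) = apSigma k y k + ∑ j ∈ univ.erase k, apSigma k y j :=
    (Finset.add_sum_erase _ _ (mem_univ k)).symm
  have h2 : ht y = y k + ∑ j ∈ univ.erase k, y j :=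
    (Finset.add_sum_erase _ _ (mem_univ k)).symm
  have h3 : ∑ j ∈ univ.erase k, apSigma k y j = ∑ j ∈ univ.erase k, y j :=
    Finset.sum_congr rfl fun j hj => apSigma_ne k j y (Finset.ne_of_mem_erase hj)
  rw [h1, h3, apSigma_self]; linarith

def PairPos (x : Fin 4 → ℝ) : Prop := ∀ i j, i ≠ j → 0 < x i + x j

lemma pair_aux (a b c d : ℝ) (h : 2 * (a^2+b^2+c^2+d^2) - (a+b+c+d)^2 = 0)
    (ha : a < 0) (hb : 0 ≤ b) (hc : 0 ≤ c) (hd : 0 ≤ d) : 0 < a + b ∧ 0 < c + d := by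
  have key : (a-b)^2 + (c-d)^2 = 2 * ((a+b)*(c+d)) := by linarith [h, sq_nonneg a, (by ring : 2 * (a^2+b^2+c^2+d^2) - (a+b+c+d)^2 = (a-b)^2 + (c-d)^2 - 2 * ((a+b)*(c+d)))]
  have hpos : 0 < (a-b)^2 := by apply sq_pos_of_neg; linarith
  have hprod : 0 < (a+b)*(c+d) := by nlinarith [sq_nonneg (c-d)]
  rcases pos_and_pos_or_neg_and_neg_of_mul_pos hprod with h | h
  · exact h
  · linarith [h.2]

lemma pairPos_base (c : Fin 4 → ℝ) (hc : IsBaseQuadruple c) : PairPos c := by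
  obtain ⟨hF, ⟨i, hi, hu⟩, -⟩ := hc
  have hn : ∀ j, j ≠ i → 0 ≤ c j := fun j hj => by
    by_contra h
    exact hj (hu j (not_le.mp h))
  simp only [DescartesF, Fin.sum_univ_four] at hF
  have main : ∀ j k l, j ≠ i → k ≠ i → l ≠ i → j ≠ k → j ≠ l → k ≠ l →
      0 < c i + c j ∧ 0 < c k + c l := by
    intro j k l hj hk hl h1 h2 h3
    refine pair_aux _ _ _ _ ?_ hi (hn j hj) (hn k hk) (hn l hl)
    clear hu hn
    fin_cases i <;> fin_cases j <;> first | (exact absurd rfl hj) | skip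
    all_goals fin_cases k <;> first | (exact absurd rfl hk) | (exact absurd rfl h1) | skip
    all_goals fin_cases l <;> first | (exact absurd rfl hl) | (exact absurd rfl h2) | (exact absurd rfl h3) | skip
    all_goals
      simp only [Fin.zero_eta, Fin.mk_one, Fin.reduceFinMk] at *
      linarith
  have ex2 : ∀ i j : Fin 4, j ≠ i → ∃ k l, k ≠ i ∧ l ≠ i ∧ j ≠ k ∧ j ≠ l ∧ k ≠ l := by decide
  have ex1 : ∀ i j k : Fin 4, j ≠ i → k ≠ i → j ≠ k → ∃ l, l ≠ i ∧ l ≠ j ∧ l ≠ k := by decide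
  intro p q hpq
  by_cases hp : p = i
  · subst hp
    obtain ⟨k, l, a1, a2, a3, a4, a5⟩ := ex2 p q hpq.symm
    exact (main q k l hpq.symm a1 a2 a3 a4 a5).1
  by_cases hq : q = i
  · subst hq
    obtain ⟨k, l, a1, a2, a3, a4, a5⟩ := ex2 q p hpq
    linarith [(main p k l hpq a1 a2 a3 a4 a5).1]
  obtain ⟨l, b1, b2, b3⟩ := ex1 i p q hp hq hpq
  exact (main l p q b1 hp hq b2 b3 hpq).2

lemma PairPos.uniq {x : Fin 4 → ℝ} (h : PairPos x) (i j : Fin 4) (hij : i ≠ j) :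
    x i + x j < ht x := by
  have ex : ∀ i j : Fin 4, i ≠ j → ∃ k l, k ≠ l ∧ (univ : Finset (Fin 4)) = {i, j, k, l} ∧
    i ≠ k ∧ i ≠ l ∧ j ≠ k ∧ j ≠ l := by decide
  obtain ⟨k, l, hkl, hu, h1, h2, h3, h4⟩ := ex i j hij
  have := h k l hkl
  have e : ht x = x i + (x j + (x k + x l)) := by
    unfold ht
    rw [hu, Finset.sum_insert (by simp [*]), Finset.sum_insert (by simp [*]),
      Finset.sum_insert (by simp [*]), Finset.sum_singleton]
  linarith

lemma reach_prop {c : Fin 4 → ℝ} (hc : IsBaseQuadruple c) {x : Fin 4 → ℝ} (hx : ApReach c x) :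
    PairPos x ∧ (x = c ∨ ∃ k, ht x < 2 * x k) := by
  induction hx with
  | base => exact ⟨pairPos_base c hc, Or.inl rfl⟩
  | step y k hy hk ih =>
    have mono : ∀ j, y j ≤ apSigma k y j := by
      intro j
      by_cases h : j = k
      · subst h; rw [apSigma_self]; linarith
      · rw [apSigma_ne _ _ _ h]
    refine ⟨fun i j hij => ?_, Or.inr ⟨k, ?_⟩⟩
    · linarith [ih.1 i j hij, mono i, mono j]
    · rw [ht_apSigma, apSigma_self]; linarith

lemma reach_sigma {c : Fin 4 → ℝ} (hc : IsBaseQuadruple c) {x : Fin 4 → ℝ} (hx : ApReach c x)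
    (j : Fin 4) : ApReach c (apSigma j x) := by
  by_cases hlt : 2 * x j < ht x
  · exact .step x j hx hlt
  have hp := (reach_prop hc hx).1
  cases hx with
  | base =>
    have e : apSigma j c = c := by
      have := hc.2.2 j
      funext i
      by_cases h : i = j
      · subst h; rw [apSigma_self]; linarith
      · rw [apSigma_ne _ _ _ h]
    rw [e]; exact .base
  | step y k hy hk =>
    by_cases h : j = k
    · subst h; rw [apSigma_apSigma]; exact hy
    · exfalso
      have h1 := hp.uniq j k h
      have h2 := ht_apSigma k y
      have h3 := apSigma_self k y
      linarith

lemma reach_W {c : Fin 4 → ℝ} (hc : IsBaseQuadruple c) (w : (Fin 4 → ℝ) ≃ₗ[ℝ] (Fin 4 → ℝ))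
    (hw : w ∈ apW) : ∀ y, ApReach c y ↔ ApReach c (w y) := by
  unfold apW at hw
  induction hw using Subgroup.closure_induction with
  | mem g hg =>
    have : ∃ k, g = apSigma k := by
      rcases hg with h | h | h | h <;> exact ⟨_, h⟩
    obtain ⟨k, rfl⟩ := this
    intro y
    refine ⟨fun h => reach_sigma hc h k, fun h => ?_⟩
    have := reach_sigma hc h k
    rwa [apSigma_apSigma] at this
  | one => intro y; rfl
  | mul a b _ _ ha hb => intro y; rw [LinearEquiv.mul_apply, hb y, ha (b y)]
  | inv a _ ha =>
    intro y
    have := ha (a⁻¹ y)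
    rw [← LinearEquiv.mul_apply, mul_inv_cancel] at this
    exact this.symm

/-- Every Descartes quadruple in the packing other than the base quadruple admits a unique
Apollonian reflection decreasing its height, namely at an index `i` with
`xᵢ > Σ_{j≠i} xⱼ`; this index carries the largest curvature. -/
theorem unique_reducing_reflection (c : Fin 4 → ℝ) (hc : IsBaseQuadruple c)
    (x : Fin 4 → ℝ) (hx : ∃ w ∈ apW, (w : (Fin 4 → ℝ) ≃ₗ[ℝ] (Fin 4 → ℝ)) c = x) (hne : x ≠ c) :
    (∃! i : Fin 4, (∑ j ∈ Finset.univ.erase i, x j) < x i) ∧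
      ∀ i : Fin 4, (∑ j ∈ Finset.univ.erase i, x j) < x i → ∀ j, x j ≤ x i := by
  obtain ⟨w, hw, rfl⟩ := hx
  have hr := (reach_W hc w hw c).1 .base
  generalize w c = x at *
  obtain ⟨hp, h | ⟨k, hk⟩⟩ := reach_prop hc hr
  · exact absurd h hne
  have e : ∀ i, ht x = x i + ∑ j ∈ univ.erase i, x j := fun i =>
    (Finset.add_sum_erase _ _ (mem_univ i)).symm
  have u : ∀ i, (∑ j ∈ Finset.univ.erase i, x j) < x i → i = k := by
    intro i hi
    by_contra h
    linarith [hp.uniq i k h, e i]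
  refine ⟨⟨k, ?_, u⟩, fun i hi j => ?_⟩
  · show _ < _
    linarith [e k]
  · by_cases h : j = i
    · rw [h]
    · linarith [hp.uniq j i h, e i]
end
end
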